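/- For every integer k ≥ 3 and every real δ > 0 there exist ε > 0 and N such that the following holds for all n ≥ N: if G is a simple graph on n vertices with at least (1 − 1/k − ε)·n(n−1)/2 edges and at most (λ_k + ε)·n^5 copies of the 5-cycle C₅, then there exists a complete multipartite graph G′ on the same vertex set (i.e., a graph whose complement is a disjoint union of cliques) such that the symmetric difference of the edge sets of G and G′ has size at most δn², where λ_k = 1/10 − 1/(2k) + 1/k² − 1/k³ + 2/(5k⁴). -/

import Mathlib

/-- The number of (unordered) copies of the 5-cycle `C₅` in a simple graph `G`:
one tenth of the number of injective graph homomorphisms from `C₅` into `G`. -/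
noncomputable def c5Count {V : Type*} (G : SimpleGraph V) : ℕ :=
  Nat.card {v : Fin 5 → V //
    Function.Injective v ∧ ∀ i : Fin 5, G.Adj (v i) (v (i + 1))} / 10

/-- The number of edges of a simple graph. -/
noncomputable def edgeCount {V : Type*} (G : SimpleGraph V) : ℕ :=
  Nat.card G.edgeSet

/-- `λ_k = 1/10 − 1/(2k) + 1/k² − 1/k³ + 2/(5k⁴)`. -/
noncomputable def lam (k : ℕ) : ℝ :=
  1/10 - 1/(2*(k:ℝ)) + 1/(k:ℝ)^2 - 1/(k:ℝ)^3 + 2/(5*(k:ℝ)^4)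

/-- The edit distance between two graphs on the same vertex set: the size of the
symmetric difference of their edge sets. -/
noncomputable def editDist {V : Type*} (G H : SimpleGraph V) : ℕ :=
  Nat.card ↥(symmDiff G.edgeSet H.edgeSet)

open Finset

section Kernel
variable {V : Type*} [Fintype V]

/-- The weighted number of closed walks of length five for the kernel `B`. -/
def closedWalkSum (B : V → V → ℝ) : ℝ :=
  ∑ a, ∑ b, ∑ c, ∑ d, ∑ e, B a b * B b c * B c d * B d e * B e a

/-- The weighted number of walks of length four for the kernel `B`
whose end points are non-adjacent. -/
def openWalkSum (B : V → V → ℝ) : ℝ :=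
  ∑ a, ∑ b, ∑ c, ∑ d, ∑ e, B a b * B b c * B c d * B d e * (1 - B e a)

/-- The weighted number of walks of length two for the kernel `B`
whose end points are non-adjacent. -/
def openCherrySum (B : V → V → ℝ) : ℝ :=
  ∑ a, ∑ b, ∑ c, B a b * B b c * (1 - B a c)

theorem sum_mul_mul_eq_sum_sq (B : V → V → ℝ) (hB : ∀ a b, B a b = B b a) (g : V → ℝ) :
    ∑ a, ∑ c, (∑ b, B a b * B b c) * (g a * g c) = ∑ b, (∑ a, B b a * g a) ^ 2 := by
  simp_rw [pow_two, sum_mul_sum, sum_mul]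
  rw [sum_congr rfl fun a _ => sum_comm, sum_comm]
  refine sum_congr rfl fun b _ => sum_congr rfl fun a _ => sum_congr rfl fun c _ => ?_
  rw [hB a b]; ring

theorem sum_mul_sum_comm (B : V → V → ℝ) (hB : ∀ a b, B a b = B b a) (g h : V → ℝ) :
    ∑ a, g a * ∑ b, B a b * h b = ∑ a, (∑ b, B a b * g b) * h a := by
  simp_rw [mul_sum, sum_mul]
  rw [sum_comm]
  refine sum_congr rfl fun b _ => sum_congr rfl fun a _ => ?_
  rw [hB a b]; ring

/-- The closed and open walks of length four together are all walks of length four. -/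
theorem closedWalkSum_add_openWalkSum (B : V → V → ℝ) (hB : ∀ a b, B a b = B b a) :
    closedWalkSum B + openWalkSum B = ∑ a, (∑ b, B a b * ∑ c, B b c) ^ 2 := by
  unfold closedWalkSum openWalkSum
  simp_rw [← sum_add_distrib, ← mul_add, add_sub_cancel, mul_one, ← mul_sum, mul_assoc, ← mul_sum]
  have h := sum_mul_sum_comm B hB (fun _ => 1) (fun b => ∑ c, B b c * ∑ d, B c d * ∑ e, B d e)
  simp only [one_mul, mul_one] at h
  rw [h, sum_mul_sum_comm B hB (fun b => ∑ c, B b c) (fun c => ∑ d, B c d * ∑ e, B d e)]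
  simp_rw [pow_two]

theorem closedWalkSum_eq_sum_mul (B : V → V → ℝ) :
    closedWalkSum B =
      ∑ a, ∑ d, (∑ c, (∑ b, B a b * B b c) * B c d) * ∑ e, B d e * B e a := by
  unfold closedWalkSum
  simp_rw [sum_mul, mul_sum]
  refine sum_congr rfl fun a _ => ?_
  rw [sum_comm, sum_congr rfl fun c _ => sum_comm, sum_comm]
  simp only [mul_assoc]

/-- Expansion of the number of closed walks of length five for the complementary kernel. -/
theorem closedWalkSum_one_sub (B : V → V → ℝ) (hB : ∀ a b, B a b = B b a)
    (d f : V → ℝ) (hd : ∀ a, d a = ∑ b, B a b) (hf : ∀ a, f a = ∑ b, B a b * d b) (n : ℝ)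
    (hn : n = Fintype.card V) :
    closedWalkSum (fun a b => 1 - B a b) =
      n ^ 5 - 5 * n ^ 3 * (∑ a, d a) + 5 * n ^ 2 * (∑ a, d a ^ 2) + 5 * n * (∑ a, d a) ^ 2
        - 5 * n * (∑ a, d a * f a) - 5 * (∑ a, d a) * (∑ a, d a ^ 2) + 5 * (∑ a, f a ^ 2)
        - closedWalkSum B := by
  set C : V → V → ℝ := fun a c => ∑ b, B a b * B b c with hC
  set D : V → V → ℝ := fun a c => ∑ b, C a b * B b c with hD
  have hd' : ∀ a, ∑ b, B b a = d a := fun a => by rw [hd]; exact sum_congr rfl fun b _ => hB b a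
  have hCs : ∀ a c, C a c = C c a := fun a c => sum_congr rfl fun b _ => by
    rw [hB a b, hB b c]; ring
  have hCrow : ∀ a, ∑ b, C a b = f a := fun a => by
    rw [hf]; simp_rw [hC]; rw [sum_comm]
    exact sum_congr rfl fun b _ => by rw [← mul_sum, hd]
  have hCcol : ∀ a, ∑ b, C b a = f a := fun a => by
    rw [← hCrow]; exact sum_congr rfl fun b _ => hCs b a
  have hfd : ∑ a, f a = ∑ a, d a ^ 2 := by
    have := sum_mul_sum_comm B hB (fun _ => 1) d
    simp only [one_mul, mul_one, ← hd, ← hf] at this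
    rw [this]; exact sum_congr rfl fun a _ => (pow_two _).symm
  have hBf : ∀ g : V → ℝ, ∑ b, g b * d b = ∑ a, ∑ b, B a b * g b := fun g => by
    rw [sum_comm]; simp_rw [← sum_mul, hd']
    exact sum_congr rfl fun b _ => mul_comm _ _
  have hDrow : ∀ a, ∑ b, D a b = ∑ b, B a b * f b := fun a => by
    simp_rw [hD]; rw [sum_comm]; simp_rw [← mul_sum, ← hd, hC, sum_mul]
    rw [sum_comm]; simp_rw [mul_assoc, ← mul_sum, ← hf]
  have hDD : ∑ a, ∑ c, D a c = ∑ a, d a * f a := by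
    simp_rw [hDrow, ← hBf]; exact sum_congr rfl fun a _ => mul_comm _ _
  have hdD : ∑ a, (∑ c, D a c) * d a = ∑ a, f a ^ 2 := by
    simp_rw [hDrow]
    have := sum_mul_sum_comm B hB d f
    simp_rw [← hf, ← pow_two] at this
    rw [← this]; exact sum_congr rfl fun a _ => mul_comm _ _
  have hA2 : ∀ a c, ∑ b, (1 - B a b) * (1 - B b c) = n - d a - d c + C a c := fun a c => by
    simp_rw [sub_mul, mul_sub, sum_sub_distrib, one_mul, mul_one, hd', ← hd, hC]
    simp [hn]; ring
  have hA3 : ∀ a c, ∑ b, (n - d a - d b + C a b) * (1 - B b c) =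
      n ^ 2 - n * d a - (∑ b, d b) + f a - n * d c + d a * d c + f c - D a c := fun a c => by
    have h1 : ∑ b, d b * B b c = f c := by
      rw [hf]; exact sum_congr rfl fun b _ => by rw [hB b c, mul_comm]
    simp_rw [mul_sub, mul_one, add_mul, sub_mul, sum_sub_distrib, sum_add_distrib,
      sum_sub_distrib, ← mul_sum, hd', h1, hCrow, hD]
    simp [← hn]; ring
  have hdD' : ∑ a, ∑ c, D a c * d c = ∑ a, f a ^ 2 := by
    simp_rw [hD, sum_mul]
    rw [sum_congr rfl fun a _ => sum_comm]
    simp_rw [mul_assoc, ← mul_sum, ← hf]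
    rw [sum_comm]; simp_rw [← sum_mul, hCcol, pow_two]
  have hCdd : ∑ a, ∑ c, C a c * (d a * d c) = ∑ a, f a ^ 2 := by
    rw [sum_mul_mul_eq_sum_sq B hB]; simp_rw [← hf]
  have hCr : ∀ g : V → ℝ, ∑ a, ∑ c, C a c * g c = ∑ a, f a * g a := fun g => by
    rw [sum_comm]; simp_rw [← sum_mul, hCcol]
  have hconst : ∀ r : ℝ, ∑ _a : V, r = n * r := fun r => by simp [hn]
  have hcomm : ∑ a, f a * d a = ∑ a, d a * f a := sum_congr rfl fun a _ => mul_comm _ _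
  rw [closedWalkSum_eq_sum_mul, closedWalkSum_eq_sum_mul B]
  simp_rw [hA2, hA3]
  change _ = _ - ∑ a, ∑ c, D a c * C c a
  set m := ∑ a, d a with hm
  have hsplit : ∀ a c, (n ^ 2 - n * d a - m + f a - n * d c + d a * d c + f c - D a c) *
      (n - d c - d a + C c a) =
      (n ^ 3 - n * m) + (m - 2 * n ^ 2) * d a + (m - 2 * n ^ 2) * d c + n * f a + n * f c
      + n * d a ^ 2 + n * d c ^ 2 + 3 * n * (d a * d c)
      - d a * f a - d c * f c - d a * f c - f a * d c - d a ^ 2 * d c - d a * d c ^ 2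
      + (n ^ 2 - m) * C a c - n * (C a c * d a) - n * (C a c * d c) + C a c * (d a * d c)
      + C a c * f a + C a c * f c - n * D a c + D a c * d a + D a c * d c - D a c * C c a := by
    intro a c; rw [hCs c a]; ring
  simp_rw [hsplit]
  simp only [sum_add_distrib, sum_sub_distrib, ← mul_sum, hCr, hdD, hdD', hDD, hCdd, hCrow,
    hconst, ← sum_mul, hfd, hcomm, ← pow_two,
    ← hm]
  ring

/-- A lower bound for closed walks of length five in terms of the density `e` of the
complementary kernel, with the open walks of length four as an error term. -/
theorem closedWalkSum_one_sub_ge (B : V → V → ℝ) (hB : ∀ a b, B a b = B b a) (e n : ℝ)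
    (hn : n = Fintype.card V) (he : ∑ a, ∑ b, B a b = e * n ^ 2) :
    (1 - 5 * e + 10 * e ^ 2 - 10 * e ^ 3 + 4 * e ^ 4) * n ^ 5 + openWalkSum B ≤
      closedWalkSum (fun a b => 1 - B a b) := by
  have hexp := closedWalkSum_one_sub B hB (fun a => ∑ b, B a b) (fun a => ∑ b, B a b * ∑ c, B b c)
    (fun _ => rfl) (fun _ => rfl) n hn
  have hopen := closedWalkSum_add_openWalkSum B hB
  have hfd := sum_mul_sum_comm B hB (fun _ => 1) (fun b => ∑ c, B b c)
  simp only [one_mul, mul_one, ← pow_two] at hfd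
  generalize hd : (fun a => ∑ b, B a b) = d at *
  have hd' : ∀ a, ∑ b, B a b = d a := fun a => by rw [← hd]
  simp only [hd'] at hexp hopen hfd he
  generalize hf : (fun a => ∑ b, B a b * d b) = f at *
  have hf' : ∀ a, ∑ b, B a b * d b = f a := fun a => by rw [← hf]
  simp only [hf'] at hexp hopen hfd
  have hsq : 0 ≤ ∑ a, (f a - 5 / 8 * n * d a + (5 / 8 * e - e ^ 2) * n ^ 2) ^ 2 :=
    sum_nonneg fun a _ => sq_nonneg _
  have hsq' : ∑ a, (f a - 5 / 8 * n * d a + (5 / 8 * e - e ^ 2) * n ^ 2) ^ 2 =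
      (∑ a, f a ^ 2) - 5 / 4 * n * (∑ a, d a * f a) + 25 / 64 * n ^ 2 * (∑ a, d a ^ 2)
      + 2 * (5 / 8 * e - e ^ 2) * n ^ 2 * (∑ a, f a)
      - 5 / 4 * n ^ 3 * (5 / 8 * e - e ^ 2) * (∑ a, d a) + n * ((5 / 8 * e - e ^ 2) * n ^ 2) ^ 2 := by
    have hc : n * ((5 / 8 * e - e ^ 2) * n ^ 2) ^ 2 =
        ∑ _a : V, ((5 / 8 * e - e ^ 2) * n ^ 2) ^ 2 := by simp [hn]
    rw [hc]
    simp_rw [mul_sum, ← sum_sub_distrib, ← sum_add_distrib, ← sum_sub_distrib, ← sum_add_distrib]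
    exact sum_congr rfl fun a _ => by ring
  have hvar : 0 ≤ ∑ a, (d a - e * n) ^ 2 := sum_nonneg fun a _ => sq_nonneg _
  have hvar' : ∑ a, (d a - e * n) ^ 2 =
      (∑ a, d a ^ 2) - 2 * e * n * (∑ a, d a) + n * (e * n) ^ 2 := by
    have hc : n * (e * n) ^ 2 = ∑ _a : V, (e * n) ^ 2 := by simp [hn]
    rw [hc]
    simp_rw [mul_sum, ← sum_sub_distrib, ← sum_add_distrib]
    exact sum_congr rfl fun a _ => by ring
  rw [hsq', hfd, he] at hsq
  rw [hvar', he] at hvar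
  rw [hexp, he]
  have hb : 0 ≤ (55 / 16 - 10 * e + 8 * e ^ 2) * n ^ 2 :=
    mul_nonneg (by nlinarith [sq_nonneg (e - 5 / 8)]) (sq_nonneg n)
  have := mul_nonneg hb hvar
  linear_combination 4 * hsq + this + hopen

/-- Walks of length two with non-adjacent end points are few
if those of length four are few. -/
theorem openCherrySum_le (B : V → V → ℝ) (hB : ∀ a b, B a b = B b a)
    (h01 : ∀ a b, B a b = 0 ∨ B a b = 1) (τ : ℝ) (hτ : 0 < τ) :
    openCherrySum B ≤ openWalkSum B / τ ^ 2 + 2 * τ * (Fintype.card V : ℝ) ^ 2 := by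
  have h0 : ∀ a b, 0 ≤ B a b := fun a b => by rcases h01 a b with h | h <;> simp [h]
  have h1 : ∀ a b, B a b ≤ 1 := fun a b => by rcases h01 a b with h | h <;> simp [h]
  set H : V → V → V → ℝ := fun a u w => B a u * B u w * (1 - B a w) with hH
  have hH0 : ∀ a u w, 0 ≤ H a u w := fun a u w =>
    mul_nonneg (mul_nonneg (h0 _ _) (h0 _ _)) (sub_nonneg.2 (h1 _ _))
  have hH01 : ∀ a u w, H a u w = 0 ∨ H a u w = 1 := fun a u w => by
    rcases h01 a u with h | h <;> rcases h01 u w with h' | h' <;> rcases h01 a w with h'' | h'' <;>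
      simp [hH, h, h', h'']
  set X : V → V → ℝ := fun a u => ∑ w, H a u w with hX
  set Y : V → V → ℝ := fun a w => ∑ u, H a u w with hY
  have hpoint : ∀ a u w, H a u w ≤
      H a u w * X a u * Y a w / τ ^ 2 + τ * (H a u w * (X a u)⁻¹) + τ * (H a u w * (Y a w)⁻¹) := by
    intro a u w
    rcases hH01 a u w with h | h
    · simp [h]
    have hx : 1 ≤ X a u := h ▸ single_le_sum (fun w _ => hH0 a u w) (mem_univ w)
    have hy : 1 ≤ Y a w := h ▸ single_le_sum (f := fun u => H a u w)
      (fun u _ => hH0 a u w) (mem_univ u)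
    rw [h, one_mul, one_mul, one_mul]
    have hx' : 0 < X a u := by linarith
    have hy' : 0 < Y a w := by linarith
    have p1 : 0 ≤ X a u * Y a w / τ ^ 2 := by positivity
    have p2 : 0 ≤ τ * (X a u)⁻¹ := by positivity
    have p3 : 0 ≤ τ * (Y a w)⁻¹ := by positivity
    by_cases hxτ : X a u ≤ τ
    · have : 1 ≤ τ * (X a u)⁻¹ := by rw [← div_eq_mul_inv, one_le_div hx']; exact hxτ
      linarith
    by_cases hyτ : Y a w ≤ τ
    · have : 1 ≤ τ * (Y a w)⁻¹ := by rw [← div_eq_mul_inv, one_le_div hy']; exact hyτ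
      linarith
    have : 1 ≤ X a u * Y a w / τ ^ 2 := by
      rw [one_le_div (by positivity)]; nlinarith
    linarith
  have hinv : ∀ x : ℝ, x * x⁻¹ ≤ 1 := fun x => by
    by_cases hx : x = 0
    · simp [hx]
    · rw [mul_inv_cancel₀ hx]
  have hXsum : ∑ a, ∑ u, ∑ w, H a u w * (X a u)⁻¹ ≤ (Fintype.card V : ℝ) ^ 2 := by
    simp_rw [← sum_mul]
    calc _ ≤ ∑ _a : V, ∑ _u : V, (1 : ℝ) :=
          sum_le_sum fun a _ => sum_le_sum fun u _ => hinv (X a u)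
      _ = _ := by simp [pow_two]
  have hYsum : ∑ a, ∑ u, ∑ w, H a u w * (Y a w)⁻¹ ≤ (Fintype.card V : ℝ) ^ 2 := by
    rw [sum_congr rfl fun a _ => sum_comm]
    simp_rw [← sum_mul]
    calc _ ≤ ∑ _a : V, ∑ _u : V, (1 : ℝ) :=
          sum_le_sum fun a _ => sum_le_sum fun w _ => hinv (Y a w)
      _ = _ := by simp [pow_two]
  have hwalk : ∑ a, ∑ u, ∑ w, H a u w * X a u * Y a w ≤ openWalkSum B := by
    have hle : ∀ a u w b v, H a u w * H a u b * H a v w ≤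
        B a v * B v w * B w u * B u b * (1 - B b a) := by
      intro a u w b v
      simp only [hH, hB w u, hB b a]
      rcases h01 a u with h | h <;> rcases h01 a v with h' | h' <;> rcases h01 a w with h'' | h'' <;>
        simp only [h, h', h'', zero_mul, mul_zero, one_mul, mul_one, sub_self, sub_zero, le_refl]
      all_goals
        rcases h01 u w with g | g <;> rcases h01 u b with g' | g' <;> rcases h01 v w with g'' | g'' <;>
        rcases h01 a b with g3 | g3 <;> simp [g, g', g'', g3]
    unfold openWalkSum
    calc _ = ∑ a, ∑ u, ∑ w, ∑ b, ∑ v, H a u w * H a u b * H a v w := by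
          simp_rw [hX, hY, mul_sum, sum_mul]
          refine sum_congr rfl fun a _ => sum_congr rfl fun u _ => sum_congr rfl fun w _ => ?_
          exact sum_comm
      _ ≤ ∑ a, ∑ u, ∑ w, ∑ b, ∑ v, B a v * B v w * B w u * B u b * (1 - B b a) := by
          exact sum_le_sum fun a _ => sum_le_sum fun u _ => sum_le_sum fun w _ =>
            sum_le_sum fun b _ => sum_le_sum fun v _ => hle a u w b v
      _ = _ := by
          refine sum_congr rfl fun a _ => ?_
          rw [sum_congr rfl fun u _ => sum_congr rfl fun w _ => sum_comm,
            sum_congr rfl fun u _ => sum_comm, sum_comm, sum_congr rfl fun v _ => sum_comm]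
  calc openCherrySum B = ∑ a, ∑ u, ∑ w, H a u w := rfl
    _ ≤ ∑ a, ∑ u, ∑ w, (H a u w * X a u * Y a w / τ ^ 2 + τ * (H a u w * (X a u)⁻¹)
          + τ * (H a u w * (Y a w)⁻¹)) :=
        sum_le_sum fun a _ => sum_le_sum fun u _ => sum_le_sum fun w _ => hpoint a u w
    _ = (∑ a, ∑ u, ∑ w, H a u w * X a u * Y a w) / τ ^ 2
          + τ * (∑ a, ∑ u, ∑ w, H a u w * (X a u)⁻¹)
          + τ * ∑ a, ∑ u, ∑ w, H a u w * (Y a w)⁻¹ := by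
        simp_rw [sum_add_distrib, ← mul_sum, ← sum_div]
    _ ≤ openWalkSum B / τ ^ 2 + τ * (Fintype.card V : ℝ) ^ 2
          + τ * (Fintype.card V : ℝ) ^ 2 := by gcongr
    _ = _ := by ring

end Kernel
section Clustering
open Classical

variable {V : Type*} [Fintype V]

/-- The ordered pairs in `S` on which `R` differs from the equivalence relation
with classes the fibres of `P`. -/
noncomputable def mismatches (R : V → V → Prop) (P : V → ℕ) (S : Finset V) : Finset (V × V) :=
  {p ∈ S ×ˢ S | ¬ (R p.1 p.2 ↔ P p.1 = P p.2)}

/-- The pairs completing `v` to a triple witnessing non-transitivity of `R` with centre `v`. -/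
noncomputable def centredAt (R : V → V → Prop) (v : V) : Finset (V × V) :=
  {p | R v p.1 ∧ R v p.2 ∧ ¬ R p.1 p.2}

/-- The pairs completing `v` to a triple witnessing non-transitivity of `R` with end point `v`. -/
noncomputable def endingAt (R : V → V → Prop) (v : V) : Finset (V × V) :=
  {p | R v p.1 ∧ R p.1 p.2 ∧ ¬ R v p.2}

/-- Splitting off the neighbourhood of `v` as a new class only costs pairs that violate
transitivity together with `v`. -/
theorem exists_card_mismatches_le_add (R : V → V → Prop) (hsymm : ∀ a b, R a b → R b a)
    (S : Finset V) (v : V) (P : V → ℕ) :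
    ∃ P' : V → ℕ, #(mismatches R P' S) ≤
      #(mismatches R P {x ∈ S | ¬ R v x}) + 2 * (#(centredAt R v) + #(endingAt R v)) := by
  refine ⟨fun x => if R v x then 0 else P x + 1, ?_⟩
  have hsub : mismatches R (fun x => if R v x then 0 else P x + 1) S ⊆
      mismatches R P {x ∈ S | ¬ R v x} ∪ centredAt R v ∪ endingAt R v ∪
        (endingAt R v).image Prod.swap := by
    rintro ⟨x, y⟩ hxy
    have hs := hsymm x y
    simp only [mismatches, centredAt, endingAt, mem_union, mem_image, mem_filter, mem_product,
      mem_univ, true_and, Prod.exists, Prod.swap_prod_mk, Prod.mk.injEq] at hxy ⊢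
    by_cases hx : R v x <;> by_cases hy : R v y <;> by_cases hR : R x y <;>
      simp_all
  have h1 := card_le_card hsub
  have h2 := card_union_le (mismatches R P {x ∈ S | ¬ R v x} ∪ centredAt R v ∪ endingAt R v)
    ((endingAt R v).image Prod.swap)
  have h3 := card_union_le (mismatches R P {x ∈ S | ¬ R v x} ∪ centredAt R v) (endingAt R v)
  have h4 := card_union_le (mismatches R P {x ∈ S | ¬ R v x}) (centredAt R v)
  have h5 : #((endingAt R v).image Prod.swap) ≤ #(endingAt R v) := card_image_le
  omega

/-- Greedy clustering: classes of size at least `D` are split off around vertices that violate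
transitivity with at most `M` pairs. -/
theorem exists_card_mismatches_le (R : V → V → Prop) (hrefl : ∀ a, R a a)
    (hsymm : ∀ a b, R a b → R b a) (M D : ℝ) (hM : 0 ≤ M) (hD : 0 < D) (S : Finset V) :
    ∃ P : V → ℕ, (#(mismatches R P S) : ℝ) ≤ 2 * M / D * #S + D * #S +
      #{v : V | M < #(centredAt R v) + #(endingAt R v)} * (Fintype.card V : ℝ) := by
  induction S using Finset.strongInduction with
  | H S ih =>
  by_cases hv : ∃ v ∈ S, (#(centredAt R v) + #(endingAt R v) : ℝ) ≤ M ∧ D ≤ #{x ∈ S | R v x}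
  · obtain ⟨v, hvS, hvM, hvD⟩ := hv
    have hss : {x ∈ S | ¬ R v x} ⊂ S := by
      refine filter_ssubset.2 ⟨v, hvS, by simpa using hrefl v⟩
    obtain ⟨P, hP⟩ := ih _ hss
    obtain ⟨P', hP'⟩ := exists_card_mismatches_le_add R hsymm S v P
    refine ⟨P', ?_⟩
    have hP'' : (#(mismatches R P' S) : ℝ) ≤
      #(mismatches R P {x ∈ S | ¬ R v x}) + 2 * (#(centredAt R v) + #(endingAt R v)) := by
      exact_mod_cast hP'
    have hcard : (#{x ∈ S | R v x} : ℝ) + #{x ∈ S | ¬ R v x} = #S := by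
      exact_mod_cast card_filter_add_card_filter_not (s := S) (fun x => R v x)
    have h1 : 2 * M / D * D = 2 * M := by field_simp
    have h2 : 2 * M / D * D ≤ 2 * M / D * #{x ∈ S | R v x} := by gcongr
    have h3 : 0 ≤ D * (#{x ∈ S | R v x} : ℝ) := by positivity
    rw [← hcard, mul_add, mul_add]
    linarith
  · push Not at hv
    refine ⟨fun x => (Fintype.equivFin V x : ℕ), ?_⟩
    set W : Finset V := {v : V | M < #(centredAt R v) + #(endingAt R v)} with hW
    have hsub : mismatches R (fun x => (Fintype.equivFin V x : ℕ)) S ⊆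
        S.biUnion fun u => {x ∈ S | R u x}.image fun x => (u, x) := by
      rintro ⟨x, y⟩ hxy
      simp only [mismatches, mem_filter, mem_product, mem_biUnion, mem_image, Prod.mk.injEq,
        Fin.val_inj, EmbeddingLike.apply_eq_iff_eq] at hxy ⊢
      refine ⟨x, hxy.1.1, y, ⟨hxy.1.2, ?_⟩, rfl, rfl⟩
      by_contra hR
      exact hxy.2 ⟨fun h => absurd h hR, fun h => h ▸ hrefl x⟩
    have h1 : #(mismatches R (fun x => (Fintype.equivFin V x : ℕ)) S) ≤ ∑ u ∈ S, #{x ∈ S | R u x} :=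
      (card_le_card hsub).trans (card_biUnion_le.trans (sum_le_sum fun u _ => card_image_le))
    have h2 : ∀ u ∈ S, (#{x ∈ S | R u x} : ℝ) ≤
        D + if u ∈ W then (Fintype.card V : ℝ) else 0 := by
      intro u hu
      by_cases huW : u ∈ W
      · rw [if_pos huW]
        have : (#{x ∈ S | R u x} : ℝ) ≤ Fintype.card V := by exact_mod_cast card_le_univ _
        linarith
      · rw [if_neg huW, add_zero]
        exact (hv u hu (by simpa [hW] using huW)).le
    calc (#(mismatches R (fun x => (Fintype.equivFin V x : ℕ)) S) : ℝ)
        ≤ ∑ u ∈ S, (#{x ∈ S | R u x} : ℝ) := by exact_mod_cast h1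
      _ ≤ ∑ u ∈ S, (D + if u ∈ W then (Fintype.card V : ℝ) else 0) := sum_le_sum h2
      _ ≤ D * #S + ∑ u : V, if u ∈ W then (Fintype.card V : ℝ) else 0 := by
          rw [sum_add_distrib, sum_const, nsmul_eq_mul, mul_comm]
          gcongr
          exact subset_univ S
      _ = D * #S + #W * (Fintype.card V : ℝ) := by simp
      _ ≤ _ := by
          have : 0 ≤ 2 * M / D * (#S : ℝ) := by positivity
          linarith

/-- Removal lemma for transitivity: a reflexive symmetric relation with few violations of
transitivity is close to an equivalence relation. -/
theorem exists_card_mismatches_univ_le (R : V → V → Prop) (hrefl : ∀ a, R a a)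
    (hsymm : ∀ a b, R a b → R b a) (δ : ℝ) (hδ : 0 < δ) (n : ℝ) (hn : n = Fintype.card V)
    (hpos : 0 < n) (hfew : ∑ v, (#(endingAt R v) : ℝ) ≤ δ ^ 3 / 256 * n ^ 3) :
    ∃ P : V → ℕ, (#(mismatches R P univ) : ℝ) ≤ δ * n ^ 2 := by
  have hsum : ∑ v, #(centredAt R v) = ∑ v, #(endingAt R v) := by
    simp_rw [centredAt, endingAt, card_filter, Fintype.sum_prod_type]
    rw [sum_comm]
    refine sum_congr rfl fun a _ => sum_congr rfl fun v _ => sum_congr rfl fun b _ => ?_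
    have : R v a ↔ R a v := ⟨hsymm _ _, hsymm _ _⟩
    simp [this]
  have hsum' : ∑ v, (#(centredAt R v) : ℝ) = ∑ v, (#(endingAt R v) : ℝ) := by exact_mod_cast hsum
  obtain ⟨P, hP⟩ := exists_card_mismatches_le R hrefl hsymm (δ ^ 2 / 32 * n ^ 2) (δ / 4 * n)
    (by positivity) (by positivity) univ
  refine ⟨P, hP.trans ?_⟩
  set W : Finset V := {v : V | δ ^ 2 / 32 * n ^ 2 < #(centredAt R v) + #(endingAt R v)} with hW
  have hWcard : (#W : ℝ) * (δ ^ 2 / 32 * n ^ 2) ≤ 2 * (δ ^ 3 / 256 * n ^ 3) := by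
    calc (#W : ℝ) * (δ ^ 2 / 32 * n ^ 2) = ∑ _v ∈ W, δ ^ 2 / 32 * n ^ 2 := by simp
      _ ≤ ∑ v ∈ W, (#(centredAt R v) + #(endingAt R v) : ℝ) :=
          sum_le_sum fun v hv => (mem_filter.1 hv).2.le
      _ ≤ ∑ v, (#(centredAt R v) + #(endingAt R v) : ℝ) :=
          sum_le_sum_of_subset_of_nonneg (subset_univ W) fun u _ _ => by positivity
      _ ≤ _ := by rw [sum_add_distrib, hsum']; linarith
  have hW' : (#W : ℝ) ≤ δ / 4 * n := by
    refine le_of_mul_le_mul_right (hWcard.trans_eq ?_) (by positivity : 0 < δ ^ 2 / 32 * n ^ 2)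
    ring
  rw [card_univ, ← hn]
  have h1 : 2 * (δ ^ 2 / 32 * n ^ 2) / (δ / 4 * n) * n = δ / 4 * n ^ 2 := by field_simp; norm_num
  rw [h1]
  nlinarith [mul_le_mul_of_nonneg_right hW' hpos.le]

end Clustering
section Graph
open Classical

variable {V : Type*} [Fintype V]

/-- Closed walks of length five that are not five-cycles revisit a vertex. -/
theorem closedWalkSum_adj_le (G : SimpleGraph V) :
    closedWalkSum (fun a b => if G.Adj a b then (1 : ℝ) else 0) ≤
      Nat.card {v : Fin 5 → V // Function.Injective v ∧ ∀ i : Fin 5, G.Adj (v i) (v (i + 1))}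
        + 5 * (Fintype.card V : ℝ) ^ 4 := by
  set I : V → V → V → V → V → Prop := fun a b c d e =>
    Function.Injective ![a, b, c, d, e] ∧
      ∀ i : Fin 5, G.Adj (![a, b, c, d, e] i) (![a, b, c, d, e] (i + 1)) with hI
  have hpoint : ∀ a b c d e, (if G.Adj a b then (1 : ℝ) else 0) * (if G.Adj b c then 1 else 0) *
      (if G.Adj c d then 1 else 0) * (if G.Adj d e then 1 else 0) * (if G.Adj e a then 1 else 0) ≤
      (if I a b c d e then 1 else 0) + (if a = c then 1 else 0) + (if a = d then 1 else 0)
        + (if b = d then 1 else 0) + (if b = e then 1 else 0) + (if c = e then 1 else 0) := by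
    intro a b c d e
    have hnonneg : ∀ (p : Prop) [Decidable p], (0 : ℝ) ≤ if p then 1 else 0 := fun p _ => by
      split_ifs <;> norm_num
    by_cases hadj : G.Adj a b ∧ G.Adj b c ∧ G.Adj c d ∧ G.Adj d e ∧ G.Adj e a
    · obtain ⟨h1, h2, h3, h4, h5⟩ := hadj
      have n1 := hnonneg (I a b c d e)
      have n2 := hnonneg (a = c)
      have n3 := hnonneg (a = d)
      have n4 := hnonneg (b = d)
      have n5 := hnonneg (b = e)
      have n6 := hnonneg (c = e)
      rw [if_pos h1, if_pos h2, if_pos h3, if_pos h4, if_pos h5]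
      by_cases hinj : a = c ∨ a = d ∨ b = d ∨ b = e ∨ c = e
      · rcases hinj with h | h | h | h | h <;> rw [if_pos h] at * <;> linarith
      · push Not at hinj
        obtain ⟨g1, g2, g3, g4, g5⟩ := hinj
        have hI' : I a b c d e := by
          refine ⟨?_, ?_⟩
          · intro i j hij
            have := h1.ne; have := h2.ne; have := h3.ne; have := h4.ne; have := h5.ne
            fin_cases i <;> fin_cases j <;> simp_all
          · intro i
            fin_cases i
            exacts [h1, h2, h3, h4, h5]
        rw [if_pos hI']
        linarith
    · have : (if G.Adj a b then (1 : ℝ) else 0) * (if G.Adj b c then 1 else 0) *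
        (if G.Adj c d then 1 else 0) * (if G.Adj d e then 1 else 0) *
        (if G.Adj e a then 1 else 0) = 0 := by
        by_contra hne
        simp only [mul_eq_zero, ite_eq_right_iff, one_ne_zero, imp_false, not_or, not_not] at hne
        tauto
      rw [this]
      positivity
  have hcount : ∑ a, ∑ b, ∑ c, ∑ d, ∑ e, (if I a b c d e then (1 : ℝ) else 0) ≤
      Nat.card {v : Fin 5 → V //
        Function.Injective v ∧ ∀ i : Fin 5, G.Adj (v i) (v (i + 1))} := by
    have hprod : ∑ a, ∑ b, ∑ c, ∑ d, ∑ e, (if I a b c d e then (1 : ℝ) else 0) =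
        #{p : V × V × V × V × V | I p.1 p.2.1 p.2.2.1 p.2.2.2.1 p.2.2.2.2} := by
      rw [card_filter]
      simp_rw [Fintype.sum_prod_type]
      push_cast
      rfl
    rw [hprod, Nat.card_eq_fintype_card, Fintype.card_subtype]
    norm_cast
    refine card_le_card_of_injOn
      (fun p => ![p.1, p.2.1, p.2.2.1, p.2.2.2.1, p.2.2.2.2]) (fun p hp => ?_) ?_
    · simpa [hI] using hp
    · rintro ⟨a, b, c, d, e⟩ _ ⟨a', b', c', d', e'⟩ _ h
      simpa using h
  unfold closedWalkSum
  calc _ ≤ ∑ a, ∑ b, ∑ c, ∑ d, ∑ e, ((if I a b c d e then (1 : ℝ) else 0)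
        + (if a = c then 1 else 0) + (if a = d then 1 else 0)
        + (if b = d then 1 else 0) + (if b = e then 1 else 0) + (if c = e then 1 else 0)) :=
        sum_le_sum fun a _ => sum_le_sum fun b _ => sum_le_sum fun c _ => sum_le_sum fun d _ =>
          sum_le_sum fun e _ => hpoint a b c d e
    _ = (∑ a, ∑ b, ∑ c, ∑ d, ∑ e, (if I a b c d e then (1 : ℝ) else 0))
        + 5 * (Fintype.card V : ℝ) ^ 4 := by
        simp only [sum_add_distrib, sum_const, card_univ, nsmul_eq_mul, ← mul_sum, sum_ite_eq,
          mem_univ, if_true, mul_one]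
        ring
    _ ≤ _ := by gcongr

/-- The density of the complement, with loops, in terms of the number of edges. -/
theorem sum_one_sub_adj (G : SimpleGraph V) :
    ∑ a, ∑ b, (if ¬ G.Adj a b then (1 : ℝ) else 0) =
      (Fintype.card V : ℝ) ^ 2 - 2 * edgeCount G := by
  have hdeg : ∑ a, ∑ b, (if G.Adj a b then (1 : ℝ) else 0) = 2 * edgeCount G := by
    have h := G.sum_degrees_eq_twice_card_edges
    have hE : edgeCount G = #G.edgeFinset := by
      rw [edgeCount, Nat.card_eq_fintype_card, SimpleGraph.edgeFinset_card]
    rw [hE]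
    have h' : ∀ a, ∑ b, (if G.Adj a b then (1 : ℝ) else 0) = G.degree a := fun a => by
      rw [← SimpleGraph.card_neighborFinset_eq_degree, SimpleGraph.neighborFinset_eq_filter,
        card_filter]
      push_cast
      rfl
    simp_rw [h']
    exact_mod_cast h
  have hsplit : ∀ a b, (if ¬ G.Adj a b then (1 : ℝ) else 0) = 1 - if G.Adj a b then 1 else 0 :=
    fun a b => by split_ifs <;> simp_all
  simp_rw [hsplit, sum_sub_distrib, hdeg]
  simp [pow_two]

theorem editDist_le_card_mismatches (G G' : SimpleGraph V) (P : V → ℕ)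
    (hG' : ∀ u v, G'.Adj u v ↔ P u ≠ P v) :
    editDist G G' ≤ #(mismatches (fun a b => ¬ G.Adj a b) P univ) := by
  have hsub : (symmDiff G.edgeSet G'.edgeSet).toFinset ⊆
      (mismatches (fun a b => ¬ G.Adj a b) P univ).image fun p => s(p.1, p.2) := by
    intro x
    induction x using Sym2.ind with
    | h u v =>
    intro h
    simp only [Set.mem_toFinset, Set.mem_symmDiff, SimpleGraph.mem_edgeSet, hG'] at h
    refine mem_image.2 ⟨(u, v), ?_, rfl⟩
    simp only [mismatches, mem_filter, mem_product, mem_univ, true_and]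
    tauto
  rw [editDist, Nat.card_eq_fintype_card, ← Set.toFinset_card]
  exact (card_le_card hsub).trans card_image_le

end Graph

/-- The polynomial `1 - 5t + 10t² - 10t³ + 4t⁴` is decreasing with slope at least `-5`. -/
theorem walk_polynomial_ge (x e ρ : ℝ) (hx0 : 0 ≤ x) (hx : x ≤ 1 / 3) (he0 : 0 ≤ e) (he1 : e ≤ 1)
    (hρ : 0 ≤ ρ) (he : e ≤ x + ρ) :
    1 - 5 * x + 10 * x ^ 2 - 10 * x ^ 3 + 4 * x ^ 4 - 5 * ρ ≤
      1 - 5 * e + 10 * e ^ 2 - 10 * e ^ 3 + 4 * e ^ 4 := by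
  have hfac : (1 - 5 * e + 10 * e ^ 2 - 10 * e ^ 3 + 4 * e ^ 4) -
      (1 - 5 * x + 10 * x ^ 2 - 10 * x ^ 3 + 4 * x ^ 4) =
      (e - x) * (-5 + 10 * (e + x) - 10 * (e ^ 2 + e * x + x ^ 2)
        + 4 * (e ^ 3 + e ^ 2 * x + e * x ^ 2 + x ^ 3)) := by ring
  rcases le_total e x with h | h
  · have hQ : -5 + 10 * (e + x) - 10 * (e ^ 2 + e * x + x ^ 2)
        + 4 * (e ^ 3 + e ^ 2 * x + e * x ^ 2 + x ^ 3) ≤ 0 := by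
      have e3 : e ≤ 1 / 3 := h.trans hx
      nlinarith [mul_nonneg he0 hx0, mul_nonneg (sub_nonneg.2 e3) he0,
        mul_nonneg (sub_nonneg.2 hx) hx0, sq_nonneg (e - x),
        mul_nonneg (mul_nonneg he0 he0) (sub_nonneg.2 e3),
        mul_nonneg (mul_nonneg hx0 hx0) (sub_nonneg.2 hx),
        mul_nonneg (mul_nonneg he0 hx0) (sub_nonneg.2 e3),
        mul_nonneg (mul_nonneg he0 hx0) (sub_nonneg.2 hx)]
    nlinarith [mul_nonneg_of_nonpos_of_nonpos (sub_nonpos.2 h) hQ]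
  · have hQ : 0 ≤ 10 * (e + x) - 10 * (e ^ 2 + e * x + x ^ 2)
        + 4 * (e ^ 3 + e ^ 2 * x + e * x ^ 2 + x ^ 3) := by
      have h1 : 0 ≤ e * (1 - e) := mul_nonneg he0 (by linarith)
      have h2 : 0 ≤ x * (1 - 3 * x) := mul_nonneg hx0 (by linarith)
      have h3 : 0 ≤ x * (1 - e) := mul_nonneg hx0 (by linarith)
      have h4 : 0 ≤ e ^ 3 + e ^ 2 * x + e * x ^ 2 + x ^ 3 := by positivity
      nlinarith
    nlinarith [mul_nonneg (sub_nonneg.2 h) hQ]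

open Classical in
/-- An upper bound for the number of walks of length four in the complement of `G`, with loops,
that have adjacent end points in `G`. -/
theorem openWalkSum_compl_le {V : Type*} [Fintype V] (G : SimpleGraph V) (x ε n : ℝ)
    (hn : n = Fintype.card V) (hn1 : 1 ≤ n) (hx0 : 0 ≤ x) (hx : x ≤ 1 / 3) (hε : 0 ≤ ε)
    (hedge : (1 - x - ε) * (n * (n - 1) / 2) ≤ edgeCount G)
    (hc5 : (c5Count G : ℝ) ≤
      ((1 - 5 * x + 10 * x ^ 2 - 10 * x ^ 3 + 4 * x ^ 4) / 10 + ε) * n ^ 5) :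
    openWalkSum (fun a b => if ¬ G.Adj a b then (1 : ℝ) else 0) ≤ 15 * ε * n ^ 5 + 19 * n ^ 4 := by
  set B : V → V → ℝ := fun a b => if ¬ G.Adj a b then (1 : ℝ) else 0 with hBdef
  have hn0 : 0 < n := by linarith
  have hB : ∀ a b, B a b = B b a := fun a b => by simp [hBdef, G.adj_comm]
  have hsum : ∑ a, ∑ b, B a b = n ^ 2 - 2 * edgeCount G := by rw [hn]; exact sum_one_sub_adj G
  set e : ℝ := (∑ a, ∑ b, B a b) / n ^ 2 with he
  have hen : ∑ a, ∑ b, B a b = e * n ^ 2 := by rw [he]; field_simp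
  have he0 : 0 ≤ e := div_nonneg
    (sum_nonneg fun a _ => sum_nonneg fun b _ => by simp only [hBdef]; split_ifs <;> norm_num)
    (by positivity)
  have he1 : e ≤ 1 := by
    rw [he, div_le_one (by positivity), hsum]
    have : (0 : ℝ) ≤ edgeCount G := Nat.cast_nonneg _
    linarith
  have hex : e ≤ x + (ε + 1 / n) := by
    rw [he, hsum, div_le_iff₀ (by positivity)]
    have h : (x + (ε + 1 / n)) * n ^ 2 = (x + ε) * n ^ 2 + n := by field_simp; ring
    rw [h]
    nlinarith [mul_nonneg (add_nonneg hx0 hε) hn0.le]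
  have hpoly := walk_polynomial_ge x e (ε + 1 / n) hx0 hx he0 he1 (by positivity) hex
  have hlower := closedWalkSum_one_sub_ge B hB e n hn hen
  have hcompl : (fun a b => 1 - B a b) = fun a b => if G.Adj a b then (1 : ℝ) else 0 := by
    funext a b
    by_cases h : G.Adj a b <;> simp [hBdef, h]
  rw [hcompl] at hlower
  have hupper := closedWalkSum_adj_le G
  rw [← hn] at hupper
  have hdiv : (Nat.card {v : Fin 5 → V //
      Function.Injective v ∧ ∀ i : Fin 5, G.Adj (v i) (v (i + 1))} : ℝ) ≤ 10 * c5Count G + 9 := by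
    unfold c5Count
    norm_cast
    omega
  have h4 : 1 ≤ n ^ 4 := one_le_pow₀ hn1
  have h5 : 1 / n * n ^ 5 = n ^ 4 := by field_simp
  have hmul := mul_le_mul_of_nonneg_right hpoly (by positivity : 0 ≤ n ^ 5)
  linarith

/-- For every `k ≥ 3` and `δ > 0` there exist `ε > 0` and `N` such that every graph on
`n ≥ N` vertices with at least `(1 − 1/k − ε)·n(n−1)/2` edges and at most
`(λ_k + ε)·n⁵` copies of `C₅` is within edit distance `δn²` of a complete multipartite
graph (a graph in which two vertices are adjacent iff they lie in different parts of
some partition). -/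
theorem close_to_multipartite (k : ℕ) (hk : 3 ≤ k) (δ : ℝ) (hδ : 0 < δ) :
    ∃ ε : ℝ, 0 < ε ∧ ∃ N : ℕ, ∀ n : ℕ, N ≤ n → ∀ G : SimpleGraph (Fin n),
      (1 - 1/(k:ℝ) - ε) * ((n:ℝ) * ((n:ℝ) - 1) / 2) ≤ (edgeCount G : ℝ) →
      (c5Count G : ℝ) ≤ (lam k + ε) * (n:ℝ)^5 →
      ∃ (G' : SimpleGraph (Fin n)) (P : Fin n → ℕ),
        (∀ u v, G'.Adj u v ↔ P u ≠ P v) ∧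
        (editDist G G' : ℝ) ≤ δ * (n:ℝ)^2 := by
  classical
  have hk' : (3 : ℝ) ≤ k := by exact_mod_cast hk
  have hk0 : (0 : ℝ) < k := by linarith
  set γ : ℝ := δ ^ 3 / 256 with hγ
  have hγ0 : 0 < γ := by positivity
  set ε : ℝ := γ ^ 3 / 512 with hε
  have hε0 : 0 < ε := by positivity
  refine ⟨ε, hε0, ⌈19 / ε⌉₊ + 1, fun n hN G hedge hc5 => ?_⟩
  have hn1 : (1 : ℝ) ≤ n := by exact_mod_cast (Nat.le_add_left 1 _).trans hN
  have hn0 : (0 : ℝ) < n := by linarith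
  have hnε : 19 ≤ ε * n := by
    have h1 : (⌈19 / ε⌉₊ : ℝ) ≤ n := by exact_mod_cast (Nat.le_add_right _ 1).trans hN
    have h2 := (Nat.le_ceil (19 / ε)).trans h1
    rwa [div_le_iff₀' hε0] at h2
  have hcard : (n : ℝ) = Fintype.card (Fin n) := by simp
  have hlam : lam k = (1 - 5 * (1 / (k : ℝ)) + 10 * (1 / (k : ℝ)) ^ 2 - 10 * (1 / (k : ℝ)) ^ 3
      + 4 * (1 / (k : ℝ)) ^ 4) / 10 := by
    unfold lam
    field_simp
    ring
  rw [hlam] at hc5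
  have hopen := openWalkSum_compl_le G (1 / k) ε n hcard hn1 (by positivity)
    (one_div_le_one_div_of_le (by norm_num) hk') hε0.le hedge hc5
  set R : Fin n → Fin n → Prop := fun a b => ¬ G.Adj a b with hR
  have hopen' : openWalkSum (fun a b => if R a b then (1 : ℝ) else 0) ≤ 16 * ε * n ^ 5 := by
    have := mul_le_mul_of_nonneg_right hnε (by positivity : 0 ≤ (n : ℝ) ^ 4)
    have h2 : openWalkSum (fun a b => if R a b then (1 : ℝ) else 0) ≤
      15 * ε * n ^ 5 + 19 * n ^ 4 := by convert hopen using 2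
    linarith
  have hsymm : ∀ a b, R a b → R b a := fun a b h h' => h h'.symm
  have hcherry := openCherrySum_le (fun a b => if R a b then (1 : ℝ) else 0)
    (fun a b => by simp [hR, G.adj_comm]) (fun a b => by by_cases h : R a b <;> simp [h])
    (γ / 4 * n) (by positivity)
  have hend : ∑ v, (#(endingAt R v) : ℝ) =
      openCherrySum (fun a b => if R a b then (1 : ℝ) else 0) := by
    unfold openCherrySum
    refine sum_congr rfl fun v _ => ?_
    rw [endingAt, card_filter, Fintype.sum_prod_type]
    push_cast
    refine sum_congr rfl fun a _ => sum_congr rfl fun b _ => ?_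
    by_cases h1 : R v a <;> by_cases h2 : R a b <;> by_cases h3 : R v b <;> simp [h1, h2, h3]
  obtain ⟨P, hP⟩ := exists_card_mismatches_univ_le R (fun a => G.irrefl) hsymm δ hδ n hcard hn0 (by
    rw [hend]
    refine hcherry.trans ?_
    rw [← hcard, ← hγ]
    have h1 : openWalkSum (fun a b => if R a b then (1 : ℝ) else 0) / (γ / 4 * n) ^ 2 ≤
        16 * ε * n ^ 5 / (γ / 4 * n) ^ 2 := by gcongr
    have h2 : 16 * ε * n ^ 5 / (γ / 4 * n) ^ 2 = γ / 2 * (n : ℝ) ^ 3 := by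
      rw [hε]; field_simp; norm_num
    linarith)
  let G' : SimpleGraph (Fin n) :=
    { Adj := fun u v => P u ≠ P v
      symm := ⟨fun _ _ h => h.symm⟩
      loopless := ⟨fun _ h => h rfl⟩ }
  refine ⟨G', P, fun u v => Iff.rfl, le_trans ?_ hP⟩
  exact_mod_cast editDist_le_card_mismatches G G' P fun u v => Iff.rfl
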